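/- Let k ≥ 2, ζ > 0, and let m_1,…,m_{k−1} ∈ [0,1]^k each be ζ-separated. Then there exists a family J of subsets of [k−1] with |J| = k and ∅ ∈ J such that the k×k matrix M[J] with rows m_R, R ∈ J (one of which is the all-ones row m_∅ = 𝟙), satisfies σ_k(M[J]) ≥ β^k · 2^{−3k/2} · k^{−3/2} and σ_max(M[J]) ≤ k. -/

import Mathlib

open Matrix

/-- The continuous linear map on Euclidean spaces associated with a real matrix. -/
noncomputable def matCLM {m n : Type*} [Fintype m] [Fintype n] [DecidableEq n]
    (A : Matrix m n ℝ) : EuclideanSpace ℝ n →L[ℝ] EuclideanSpace ℝ m :=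
  LinearMap.toContinuousLinearMap (Matrix.toEuclideanLin A)

/-- The largest singular value of `A`: the supremum of `‖A z‖` over unit vectors `z`. -/
noncomputable def sigmaMax {m n : Type*} [Fintype m] [Fintype n] [DecidableEq n]
    (A : Matrix m n ℝ) : ℝ :=
  sSup {t : ℝ | ∃ z : EuclideanSpace ℝ n, ‖z‖ = 1 ∧ t = ‖matCLM A z‖}

/-- The smallest singular value of a matrix `A` with at least as many rows as columns:
the infimum of `‖A z‖` over unit vectors `z`. -/
noncomputable def sigmaMin {m n : Type*} [Fintype m] [Fintype n] [DecidableEq n]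
    (A : Matrix m n ℝ) : ℝ :=
  sInf {t : ℝ | ∃ z : EuclideanSpace ℝ n, ‖z‖ = 1 ∧ t = ‖matCLM A z‖}

/-- `β = (ζ/2)^(k−1) / (3k³)`. -/
noncomputable def beta (k : ℕ) (ζ : ℝ) : ℝ := (ζ / 2) ^ (k - 1) / (3 * (k : ℝ) ^ 3)

section SingularValues

variable {n : Type*} [Fintype n] [DecidableEq n]

theorem matCLM_apply (A : Matrix n n ℝ) (z : EuclideanSpace ℝ n) (i : n) :
    matCLM A z i = ∑ j, A i j * z j := by
  simp [matCLM, Matrix.mulVec, dotProduct]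

theorem matCLM_mul_apply (A B : Matrix n n ℝ) (z : EuclideanSpace ℝ n) :
    matCLM (A * B) z = matCLM A (matCLM B z) := by
  simp [matCLM]

/-- A matrix with entries bounded by `c` has operator norm at most `card n * c`. -/
theorem norm_matCLM_le (A : Matrix n n ℝ) {c : ℝ} (hc : 0 ≤ c) (hA : ∀ i j, |A i j| ≤ c)
    (z : EuclideanSpace ℝ n) : ‖matCLM A z‖ ≤ Fintype.card n * c * ‖z‖ := by
  refine abs_le_of_sq_le_sq' ?_ (by positivity) |>.2
  rw [EuclideanSpace.real_norm_sq_eq, mul_pow, EuclideanSpace.real_norm_sq_eq]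
  calc ∑ i, (matCLM A z i) ^ 2
      ≤ ∑ _i : n, (Fintype.card n * c ^ 2) * ∑ j, z j ^ 2 := by
        refine Finset.sum_le_sum fun i _ => ?_
        rw [matCLM_apply]
        refine (Finset.sum_mul_sq_le_sq_mul_sq _ _ _).trans ?_
        refine mul_le_mul_of_nonneg_right ?_ (Finset.sum_nonneg fun j _ => sq_nonneg _)
        calc ∑ j, A i j ^ 2 ≤ ∑ _j : n, c ^ 2 :=
              Finset.sum_le_sum fun j _ => sq_le_sq.2 ((hA i j).trans (le_abs_self c))
          _ = Fintype.card n * c ^ 2 := by simp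
    _ = (Fintype.card n * c) ^ 2 * ∑ j, z j ^ 2 := by
        simp only [Finset.sum_const, Finset.card_univ, nsmul_eq_mul]
        ring

theorem abs_adjugate_le (A : Matrix n n ℝ) (hA : ∀ i j, |A i j| ≤ 1) (i j : n) :
    |A.adjugate i j| ≤ (Fintype.card n).factorial := by
  rw [Matrix.adjugate_apply]
  have h := Matrix.det_le (A := A.updateRow j (Pi.single i 1))
    (abv := AbsoluteValue.abs) (x := (1 : ℝ)) (fun a b => by
      rw [Matrix.updateRow_apply]
      split_ifs
      · rw [Pi.single_apply]
        split_ifs <;> simp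
      · exact hA a b)
  simpa using h

theorem abs_det_mul_norm_le (A : Matrix n n ℝ) (hA : ∀ i j, |A i j| ≤ 1)
    (z : EuclideanSpace ℝ n) :
    |A.det| * ‖z‖ ≤
      Fintype.card n * (Fintype.card n).factorial * ‖matCLM A z‖ := by
  have h : matCLM A.adjugate (matCLM A z) = A.det • z := by
    rw [← matCLM_mul_apply, Matrix.adjugate_mul]
    simp [matCLM]
  rw [← Real.norm_eq_abs, ← norm_smul, ← h]
  exact norm_matCLM_le _ (by positivity) (abs_adjugate_le A hA) _

theorem exists_norm_eq_one [Nonempty n] : ∃ z : EuclideanSpace ℝ n, ‖z‖ = 1 :=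
  ⟨EuclideanSpace.single (Classical.arbitrary n) 1, by simp⟩

theorem sigmaMax_le_card [Nonempty n] (A : Matrix n n ℝ) (hA : ∀ i j, |A i j| ≤ 1) :
    sigmaMax A ≤ Fintype.card n := by
  refine csSup_le (exists_norm_eq_one.imp' _ fun z hz => ⟨z, hz, rfl⟩) ?_
  rintro t ⟨z, hz, rfl⟩
  simpa [hz] using norm_matCLM_le A zero_le_one hA z

theorem abs_det_div_le_sigmaMin [Nonempty n] (A : Matrix n n ℝ) (hA : ∀ i j, |A i j| ≤ 1) :
    |A.det| / (Fintype.card n * (Fintype.card n).factorial) ≤ sigmaMin A := by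
  refine le_csInf (exists_norm_eq_one.imp' _ fun z hz => ⟨z, hz, rfl⟩) ?_
  rintro t ⟨z, hz, rfl⟩
  rw [div_le_iff₀' (by have := Fintype.card_pos (α := n); positivity)]
  simpa [hz] using abs_det_mul_norm_le A hA z

end SingularValues

/-- If every row of a square matrix is a combination of the vectors `v R`, `R ∈ S a`, with
coefficients in `[-1, 1]`, then some choice of the vectors has a determinant which is at least
the average over all choices. -/
theorem exists_abs_det_le_prod_card_mul {n ι : Type*} [Fintype n] [DecidableEq n]
    (v : ι → n → ℝ) (S : n → Finset ι) (hS : ∀ a, (S a).Nonempty) (c : n → ι → ℝ)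
    (hc : ∀ a R, |c a R| ≤ 1) :
    ∃ r : n → ι, (∀ a, r a ∈ S a) ∧
      |(Matrix.of fun a => ∑ R ∈ S a, c a R • v R).det| ≤
        (∏ a, (S a).card : ℕ) * |(Matrix.of fun a => v (r a)).det| := by
  obtain ⟨r, hr, hmax⟩ := Finset.exists_max_image (Fintype.piFinset S)
    (fun r => |(Matrix.of fun a => v (r a)).det|) (Fintype.piFinset_nonempty.2 hS)
  refine ⟨r, Fintype.mem_piFinset.1 hr, ?_⟩
  have hexp : (Matrix.of fun a => ∑ R ∈ S a, c a R • v R).det =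
      ∑ r ∈ Fintype.piFinset S, (∏ a, c a (r a)) * (Matrix.of fun a => v (r a)).det := by
    refine ((Matrix.detRowAlternating (R := ℝ) (n := n)).toMultilinearMap.map_sum_finset
      (fun a R => c a R • v R) S).trans (Finset.sum_congr rfl fun r _ => ?_)
    exact (Matrix.detRowAlternating (R := ℝ) (n := n)).toMultilinearMap.map_smul_univ
      (fun a => c a (r a)) (fun a => v (r a))
  rw [hexp, ← Fintype.card_piFinset, ← nsmul_eq_mul]
  refine (Finset.abs_sum_le_sum_abs _ _).trans (Finset.sum_le_card_nsmul _ _ _ fun s hs => ?_)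
  rw [abs_mul, Finset.abs_prod]
  exact (mul_le_of_le_one_left (abs_nonneg _)
    (Finset.prod_le_one (fun _ _ => abs_nonneg _) fun a _ => hc a _)).trans (hmax s hs)

/-- Some `n + 1` Hadamard products of `n` separated vectors, the empty product among them,
have a large determinant. -/
theorem exists_le_abs_det_prod {n : ℕ} {ζ : ℝ} (hζ : 0 < ζ) (hζ1 : ζ ≤ 1)
    (m : Fin n → Fin (n + 1) → ℝ) (hmem : ∀ i j, m i j ∈ Set.Icc (0 : ℝ) 1)
    (hsep : ∀ i, ∀ a b, a ≠ b → ζ ≤ |m i a - m i b|) :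
    ∃ J : Fin (n + 1) → Finset (Fin n), J 0 = ∅ ∧
      ((ζ / 2) ^ n) ^ (n + 1) ≤ |(Matrix.of fun a j => ∏ i ∈ J a, m i j).det| := by
  set c : Fin (n + 1) → Finset (Fin n) → ℝ := fun a R =>
    if a = 0 then 1 else ∏ i ∈ Finset.univ \ R, -m i (a.succAbove i) with hc_def
  set S : Fin (n + 1) → Finset (Finset (Fin n)) := fun a =>
    if a = 0 then {∅} else Finset.univ.powerset with hS_def
  set v : Finset (Fin n) → Fin (n + 1) → ℝ := fun R j => ∏ i ∈ R, m i j with hv_def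
  have hS : ∀ a, (S a).Nonempty := fun a => by
    simp only [hS_def]
    split_ifs
    · exact Finset.singleton_nonempty _
    · exact Finset.powerset_nonempty _
  have hc : ∀ a R, |c a R| ≤ 1 := fun a R => by
    simp only [hc_def]
    split_ifs
    · simp
    · rw [Finset.abs_prod]
      refine Finset.prod_le_one (fun _ _ => abs_nonneg _) fun i _ => ?_
      rw [abs_neg, abs_of_nonneg (hmem _ _).1]
      exact (hmem _ _).2
  obtain ⟨r, hr, hdet⟩ := exists_abs_det_le_prod_card_mul v S hS c hc
  refine ⟨r, by simpa [hS_def] using hr 0, ?_⟩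
  have hrow0 : ∀ j, (∑ R ∈ S 0, c 0 R • v R) j = 1 := fun j => by
    simp [hS_def, hc_def, hv_def]
  have hrow : ∀ a, a ≠ 0 → ∀ j,
      (∑ R ∈ S a, c a R • v R) j = ∏ i, (m i j - m i (a.succAbove i)) := fun a ha j => by
    simp only [hS_def, hc_def, hv_def, if_neg ha, sub_eq_add_neg, Finset.prod_add,
      Finset.sum_apply, Pi.smul_apply, smul_eq_mul]
    exact Finset.sum_congr rfl fun R _ => mul_comm _ _
  have htri : (Matrix.of fun a => ∑ R ∈ S a, c a R • v R).BlockTriangular id := by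
    intro a j hja
    have ha : a ≠ 0 := (lt_of_le_of_lt (Fin.zero_le j) hja).ne'
    obtain ⟨i, hi⟩ := Fin.exists_succAbove_eq (ne_of_lt hja)
    rw [Matrix.of_apply, hrow a ha]
    exact Finset.prod_eq_zero (Finset.mem_univ i) (sub_eq_zero.2 (congrArg (m i) hi.symm))
  have hlow : (ζ ^ n) ^ (n + 1) ≤ |(Matrix.of fun a => ∑ R ∈ S a, c a R • v R).det| := by
    rw [Matrix.det_of_isUpperTriangular htri, Finset.abs_prod]
    calc (ζ ^ n) ^ (n + 1) = ∏ _a : Fin (n + 1), ζ ^ n := by simp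
      _ ≤ _ := Finset.prod_le_prod (fun _ _ => by positivity) fun a _ => ?_
    rw [Matrix.of_apply]
    rcases eq_or_ne a 0 with rfl | ha
    · rw [hrow0, abs_one]
      exact pow_le_one₀ hζ.le hζ1
    · rw [hrow a ha, Finset.abs_prod]
      calc ζ ^ n = ∏ _i : Fin n, ζ := by simp
        _ ≤ _ := Finset.prod_le_prod (fun _ _ => hζ.le) fun i _ =>
          hsep i _ _ (Fin.succAbove_ne a i).symm
  have hcard : ((∏ a, (S a).card : ℕ) : ℝ) ≤ (2 ^ n) ^ (n + 1) := by
    have : ∏ a, (S a).card ≤ ∏ _a : Fin (n + 1), 2 ^ n := by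
      refine Finset.prod_le_prod' fun a _ => ?_
      simp only [hS_def]
      split_ifs
      · simpa using Nat.one_le_two_pow
      · simp
    exact_mod_cast this.trans_eq (by simp)
  rw [div_pow, div_pow, div_le_iff₀' (by positivity)]
  exact (hlow.trans hdet).trans (mul_le_mul_of_nonneg_right hcard (abs_nonneg _))

theorem beta_pow_mul_le {n : ℕ} (hn : 1 ≤ n) {ζ : ℝ} (hζ : 0 < ζ) :
    beta (n + 1) ζ ^ (n + 1) * (2 : ℝ) ^ (-(3 * ((n + 1 : ℕ) : ℝ)) / 2) *
        ((n + 1 : ℕ) : ℝ) ^ (-(3 : ℝ) / 2) ≤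
      ((ζ / 2) ^ n) ^ (n + 1) / (((n + 1 : ℕ) : ℝ) * (n + 1).factorial) := by
  have hk : (1 : ℝ) ≤ ((n + 1 : ℕ) : ℝ) := by exact_mod_cast Nat.succ_pos n
  have h2 : (2 : ℝ) ^ (-(3 * ((n + 1 : ℕ) : ℝ)) / 2) ≤ 1 :=
    Real.rpow_le_one_of_one_le_of_nonpos one_le_two (by linarith)
  have h3 : ((n + 1 : ℕ) : ℝ) ^ (-(3 : ℝ) / 2) ≤ 1 :=
    Real.rpow_le_one_of_one_le_of_nonpos hk (by norm_num)
  have hb : 0 ≤ beta (n + 1) ζ := by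
    unfold beta
    positivity
  refine (mul_le_of_le_one_right (by positivity) h3).trans
    ((mul_le_of_le_one_right (by positivity) h2).trans ?_)
  rw [beta, div_pow, Nat.add_sub_cancel]
  refine div_le_div_of_nonneg_left (by positivity) (by positivity) ?_
  have hf : (n + 1) * (n + 1).factorial ≤ (3 * (n + 1) ^ 3) ^ (n + 1) := by
    calc (n + 1) * (n + 1).factorial ≤ (n + 1) ^ (n + 1) * (n + 1) ^ (n + 1) :=
          Nat.mul_le_mul (Nat.le_self_pow (by omega) _) (Nat.factorial_le_pow _)
      _ = ((n + 1) ^ 2) ^ (n + 1) := by rw [← mul_pow, sq]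
      _ ≤ _ := Nat.pow_le_pow_left ((Nat.pow_le_pow_right (by omega) (by omega)).trans
          (Nat.le_mul_of_pos_left _ (by omega))) _
  exact_mod_cast hf

/-- Let `k ≥ 2`, `ζ > 0`, and let `m_1, …, m_{k−1} ∈ [0,1]ᵏ` each be `ζ`-separated. Then
there are `k` distinct subsets `𝒥 1, …, 𝒥 k ⊆ [k−1]`, one of them empty (so that the
corresponding row is the all-ones row `m_∅ = 𝟙`), such that the `k × k` matrix `M[J]`
with rows `m_R = ⊙_{i∈R} m_i`, `R ∈ J`, satisfies
`σ_k(M[J]) ≥ βᵏ·2^(−3k/2)·k^(−3/2)` and `σ_max(M[J]) ≤ k`. -/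
theorem stmt10 {k : ℕ} (hk : 2 ≤ k) (ζ : ℝ) (hζ : 0 < ζ)
    (m : Fin (k - 1) → Fin k → ℝ)
    (hmem : ∀ i j, m i j ∈ Set.Icc (0 : ℝ) 1)
    (hsep : ∀ i, ∀ a b, a ≠ b → ζ ≤ |m i a - m i b|) :
    ∃ 𝒥 : Fin k → Finset (Fin (k - 1)), Function.Injective 𝒥 ∧ (∃ a, 𝒥 a = ∅) ∧
      beta k ζ ^ k * (2 : ℝ) ^ (-(3 * (k : ℝ)) / 2) * (k : ℝ) ^ (-(3 : ℝ) / 2) ≤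
        sigmaMin (Matrix.of fun (a : Fin k) (j : Fin k) => ∏ i ∈ 𝒥 a, m i j) ∧
      sigmaMax (Matrix.of fun (a : Fin k) (j : Fin k) => ∏ i ∈ 𝒥 a, m i j) ≤ (k : ℝ) := by
  obtain ⟨n, rfl⟩ : ∃ n, k = n + 1 := ⟨k - 1, by omega⟩
  have hn : 1 ≤ n := by omega
  have hζ1 : ζ ≤ 1 := by
    refine (hsep ⟨0, by omega⟩ ⟨0, by omega⟩ ⟨1, by omega⟩ (by simp)).trans ?_
    have h0 := hmem ⟨0, by omega⟩ ⟨0, by omega⟩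
    have h1 := hmem ⟨0, by omega⟩ ⟨1, by omega⟩
    exact abs_sub_le_iff.2 ⟨by linarith [h0.2, h1.1], by linarith [h0.1, h1.2]⟩
  obtain ⟨J, hJ0, hdet⟩ := exists_le_abs_det_prod (n := n) hζ hζ1 m hmem hsep
  have hentry : ∀ a j, |(Matrix.of fun a j => ∏ i ∈ J a, m i j) a j| ≤ 1 := fun a j => by
    rw [Matrix.of_apply, Finset.abs_prod]
    refine Finset.prod_le_one (fun _ _ => abs_nonneg _) fun i _ => ?_
    rw [abs_of_nonneg (hmem i j).1]
    exact (hmem i j).2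
  refine ⟨J, fun a b hab => ?_, ⟨0, hJ0⟩, ?_, ?_⟩
  · by_contra hne
    have hzero : (Matrix.of fun a j => ∏ i ∈ J a, m i j).det = 0 :=
      Matrix.det_zero_of_row_eq hne (by ext j; simp [hab])
    rw [hzero, abs_zero] at hdet
    exact absurd hdet (not_le.2 (by positivity))
  · refine (beta_pow_mul_le hn hζ).trans (le_trans ?_ (abs_det_div_le_sigmaMin _ hentry))
    rw [Fintype.card_fin]
    exact div_le_div_of_nonneg_right hdet (by positivity)
  · simpa using sigmaMax_le_card _ hentry
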